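/- arXiv:1102.5583 — 6 statements merged into one kernel-verified Lean document; each statement's English description precedes it below -/
import Mathlib

section
/- The infimum defining the mobile distance is attained: for any v⁰, v¹ ∈ L² there exist q ∈ ℝ^d and j ∈ {0,1} such that m_φ(v⁰, v¹)² = ‖v^{1−j} − τ_q v^j‖₂² + |q|² φ(‖v^j‖₂)². -/
open MeasureTheory Filter

noncomputable section

/-- Translation `(τ_q v)(x) = v(x - q)` acting on `L²(ℝ^d; ℝ)`. -/
def tau {d : ℕ} (q : EuclideanSpace ℝ (Fin d))
    (v : Lp ℝ 2 (volume : Measure (EuclideanSpace ℝ (Fin d)))) :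
    Lp ℝ 2 (volume : Measure (EuclideanSpace ℝ (Fin d))) :=
  Lp.compMeasurePreserving (fun x => x - q) (measurePreserving_sub_right volume q) v

/-- The squared mobile distance
`m_φ(v⁰, v¹)² = inf { ‖v^{1−j} − τ_q v^j‖₂² + |q|² φ(‖v^j‖₂)² : q ∈ ℝ^d, j ∈ {0,1} }`. -/
def mobSq {d : ℕ} (φ : ℝ → ℝ)
    (v0 v1 : Lp ℝ 2 (volume : Measure (EuclideanSpace ℝ (Fin d)))) : ℝ :=
  sInf {r : ℝ | ∃ q : EuclideanSpace ℝ (Fin d),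
      r = ‖v1 - tau q v0‖ ^ 2 + ‖q‖ ^ 2 * φ ‖v0‖ ^ 2 ∨
      r = ‖v0 - tau q v1‖ ^ 2 + ‖q‖ ^ 2 * φ ‖v1‖ ^ 2}

/-- The mobile distance `m_φ`. -/
def mob {d : ℕ} (φ : ℝ → ℝ)
    (v0 v1 : Lp ℝ 2 (volume : Measure (EuclideanSpace ℝ (Fin d)))) : ℝ :=
  Real.sqrt (mobSq φ v0 v1)

end

/-- Translations act strongly continuously on `L²(ℝ^d; ℝ)`. -/
theorem continuous_tau {d : ℕ} (v : Lp ℝ 2 (volume : Measure (EuclideanSpace ℝ (Fin d)))) :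
    Continuous fun q => tau q v := by
  let g : C(EuclideanSpace ℝ (Fin d), C(EuclideanSpace ℝ (Fin d), EuclideanSpace ℝ (Fin d))) :=
    (ContinuousMap.mk (fun a : EuclideanSpace ℝ (Fin d) × EuclideanSpace ℝ (Fin d) => a.2 - a.1)
      (continuous_snd.sub continuous_fst)).curry
  exact Continuous.compMeasurePreservingLp (p := 2) (f := fun _ => v) (g := g)
    continuous_const g.continuous (measurePreserving_sub_right volume) ENNReal.ofNat_ne_top

/-- The penalized translation cost from `v` to `w` attains its minimum over all translations. -/
theorem exists_translation_cost_le {d : ℕ} (φ : ℝ → ℝ) (hφ : ∀ a : ℝ, 0 ≤ a → a ≤ φ a)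
    (v w : Lp ℝ 2 (volume : Measure (EuclideanSpace ℝ (Fin d)))) :
    ∃ q : EuclideanSpace ℝ (Fin d), ∀ p : EuclideanSpace ℝ (Fin d),
      ‖w - tau q v‖ ^ 2 + ‖q‖ ^ 2 * φ ‖v‖ ^ 2 ≤ ‖w - tau p v‖ ^ 2 + ‖p‖ ^ 2 * φ ‖v‖ ^ 2 := by
  rcases eq_or_ne v 0 with rfl | hv
  · have h (q : EuclideanSpace ℝ (Fin d)) : tau q 0 = 0 :=
      map_zero (Lp.compMeasurePreserving _ (measurePreserving_sub_right volume q))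
    refine ⟨0, fun p => ?_⟩
    simp only [h, norm_zero]
    gcongr
    positivity
  · have hpos : 0 < φ ‖v‖ ^ 2 :=
      pow_pos ((norm_pos_iff.mpr hv).trans_le (hφ _ (norm_nonneg v))) 2
    refine Continuous.exists_forall_le
      (f := fun q => ‖w - tau q v‖ ^ 2 + ‖q‖ ^ 2 * φ ‖v‖ ^ 2) ?_ ?_
    · have := continuous_tau v
      fun_prop
    · refine tendsto_atTop_mono (fun q => le_add_of_nonneg_left (sq_nonneg _)) ?_
      exact ((tendsto_pow_atTop two_ne_zero).comp
        (tendsto_norm_cocompact_atTop (E := EuclideanSpace ℝ (Fin d)))).atTop_mul_const hpos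

/-- **The infimum defining the mobile distance is attained**: for any `v⁰, v¹ ∈ L²(ℝ^d)`
there exist `q ∈ ℝ^d` and `j ∈ {0,1}` realizing the infimum in the definition of
`m_φ(v⁰, v¹)²`. -/
theorem mobSq_inf_attained {d : ℕ} (hd : 0 < d) (φ : ℝ → ℝ)
    (hφc : ContinuousOn φ (Set.Ici 0)) (hφm : MonotoneOn φ (Set.Ici 0))
    (hφ1 : ∀ a : ℝ, 0 ≤ a → a ≤ φ a)
    (hφ4 : ∀ a b : ℝ, 0 ≤ a → 0 ≤ b → b ≤ 2 * a → φ b ≤ 4 * φ a)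
    (v0 v1 : Lp ℝ 2 (volume : Measure (EuclideanSpace ℝ (Fin d)))) :
    ∃ q : EuclideanSpace ℝ (Fin d),
      mobSq φ v0 v1 = ‖v1 - tau q v0‖ ^ 2 + ‖q‖ ^ 2 * φ ‖v0‖ ^ 2 ∨
      mobSq φ v0 v1 = ‖v0 - tau q v1‖ ^ 2 + ‖q‖ ^ 2 * φ ‖v1‖ ^ 2 := by
  obtain ⟨q₀, h₀⟩ := exists_translation_cost_le φ hφ1 v0 v1
  obtain ⟨q₁, h₁⟩ := exists_translation_cost_le φ hφ1 v1 v0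
  rcases le_total (‖v1 - tau q₀ v0‖ ^ 2 + ‖q₀‖ ^ 2 * φ ‖v0‖ ^ 2)
    (‖v0 - tau q₁ v1‖ ^ 2 + ‖q₁‖ ^ 2 * φ ‖v1‖ ^ 2) with h | h
  · refine ⟨q₀, Or.inl (IsLeast.csInf_eq ⟨⟨q₀, Or.inl rfl⟩, ?_⟩)⟩
    rintro r ⟨p, rfl | rfl⟩
    · exact h₀ p
    · exact h.trans (h₁ p)
  · refine ⟨q₁, Or.inr (IsLeast.csInf_eq ⟨⟨q₁, Or.inr rfl⟩, ?_⟩)⟩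
    rintro r ⟨p, rfl | rfl⟩
    · exact h.trans (h₀ p)
    · exact h₁ p
end

section
/- Quasi-triangle inequality for the mobile distance: there is a constant C ≥ 1, depending at most on the dimension d and independent of the cut-off function φ, such that for all v⁰, v¹, v² ∈ L², m_φ(v⁰, v¹) ≤ C (m_φ(v⁰, v²) + m_φ(v², v¹)). -/
open MeasureTheory Filter

section Translation

variable {d : ℕ}

lemma norm_tau (q : EuclideanSpace ℝ (Fin d))
    (v : Lp ℝ 2 (volume : Measure (EuclideanSpace ℝ (Fin d)))) : ‖tau q v‖ = ‖v‖ :=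
  Lp.norm_compMeasurePreserving v _

lemma tau_sub (q : EuclideanSpace ℝ (Fin d))
    (v w : Lp ℝ 2 (volume : Measure (EuclideanSpace ℝ (Fin d)))) :
    tau q (v - w) = tau q v - tau q w :=
  map_sub (Lp.compMeasurePreserving _ (measurePreserving_sub_right volume q)) v w

lemma coeFn_tau (q : EuclideanSpace ℝ (Fin d))
    (v : Lp ℝ 2 (volume : Measure (EuclideanSpace ℝ (Fin d)))) :
    tau q v =ᵐ[volume] fun x => v (x - q) :=
  Lp.coeFn_compMeasurePreserving v _

lemma tau_zero (v : Lp ℝ 2 (volume : Measure (EuclideanSpace ℝ (Fin d)))) : tau 0 v = v := by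
  refine Lp.ext ((coeFn_tau 0 v).trans ?_)
  simp

lemma tau_tau (p q : EuclideanSpace ℝ (Fin d))
    (v : Lp ℝ 2 (volume : Measure (EuclideanSpace ℝ (Fin d)))) :
    tau p (tau q v) = tau (p + q) v := by
  refine Lp.ext ?_
  filter_upwards [coeFn_tau p (tau q v), coeFn_tau (p + q) v,
    (measurePreserving_sub_right volume p).quasiMeasurePreserving.ae (coeFn_tau q v)]
    with x h₁ h₂ h₃
  rw [h₁, h₂, h₃, sub_sub]

lemma norm_sub_tau_neg (q : EuclideanSpace ℝ (Fin d))
    (v w : Lp ℝ 2 (volume : Measure (EuclideanSpace ℝ (Fin d)))) :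
    ‖v - tau (-q) w‖ = ‖w - tau q v‖ := by
  rw [← norm_tau q, tau_sub, tau_tau, add_neg_cancel, tau_zero, norm_sub_rev]

end Translation

section MobileDistance

variable {d : ℕ} {φ : ℝ → ℝ}

/-- The mobile distance is bounded by the cost of any translation, where the translation itself
is charged at the smaller of the two norms. -/
lemma mob_le (hφ : ∀ a : ℝ, 0 ≤ a → a ≤ φ a)
    (v0 v1 : Lp ℝ 2 (volume : Measure (EuclideanSpace ℝ (Fin d))))
    (q : EuclideanSpace ℝ (Fin d)) :
    mob φ v0 v1 ≤ ‖v1 - tau q v0‖ + ‖q‖ * φ (min ‖v0‖ ‖v1‖) := by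
  have hmin : 0 ≤ min ‖v0‖ ‖v1‖ := le_min (norm_nonneg _) (norm_nonneg _)
  have hφ0 : 0 ≤ φ (min ‖v0‖ ‖v1‖) := hmin.trans (hφ _ hmin)
  have hcost : 0 ≤ ‖q‖ * φ (min ‖v0‖ ‖v1‖) := by positivity
  refine Real.sqrt_le_iff.2 ⟨by positivity, ?_⟩
  have hle : mobSq φ v0 v1 ≤ ‖v1 - tau q v0‖ ^ 2 + ‖q‖ ^ 2 * φ (min ‖v0‖ ‖v1‖) ^ 2 := by
    refine csInf_le ⟨0, ?_⟩ ?_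
    · rintro r ⟨p, rfl | rfl⟩ <;> positivity
    · rcases le_total ‖v0‖ ‖v1‖ with h | h
      · exact ⟨q, Or.inl (by rw [min_eq_left h])⟩
      · exact ⟨-q, Or.inr (by rw [min_eq_right h, norm_sub_tau_neg, norm_neg])⟩
  nlinarith [mul_nonneg (norm_nonneg (v1 - tau q v0)) hcost]

/-- Near-optimal translations for the mobile distance. -/
lemma exists_tau_of_mob_lt (hmono : MonotoneOn φ (Set.Ici 0))
    {v0 v1 : Lp ℝ 2 (volume : Measure (EuclideanSpace ℝ (Fin d)))} {m : ℝ}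
    (hm : mob φ v0 v1 < m) :
    ∃ q : EuclideanSpace ℝ (Fin d),
      ‖v1 - tau q v0‖ ≤ m ∧ ‖q‖ * φ (min ‖v0‖ ‖v1‖) ≤ m := by
  have hm0 : 0 < m := (Real.sqrt_nonneg _).trans_lt hm
  have hmin : 0 ≤ min ‖v0‖ ‖v1‖ := le_min (norm_nonneg _) (norm_nonneg _)
  have hsq : mobSq φ v0 v1 < m ^ 2 := (Real.sqrt_lt' hm0).1 hm
  obtain ⟨r, ⟨q, hr⟩, hrm⟩ := exists_lt_of_csInf_lt (by exact ⟨_, 0, Or.inl rfl⟩) hsq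
  have bound : ∀ {x y a : ℝ}, min ‖v0‖ ‖v1‖ ≤ a → r = x ^ 2 + y ^ 2 * φ a ^ 2 → 0 ≤ y →
      x ≤ m ∧ y * φ (min ‖v0‖ ‖v1‖) ≤ m := by
    intro x y a ha hxy hy
    have h : y * φ (min ‖v0‖ ‖v1‖) ≤ y * φ a :=
      mul_le_mul_of_nonneg_left (hmono hmin (hmin.trans ha) ha) hy
    rw [← mul_pow] at hxy
    exact ⟨(abs_le_of_sq_le_sq' (by nlinarith [sq_nonneg (y * φ a)]) hm0.le).2,
      h.trans (abs_le_of_sq_le_sq' (by nlinarith [sq_nonneg x]) hm0.le).2⟩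
  rcases hr with hr | hr
  · exact ⟨q, bound (min_le_left _ _) hr (norm_nonneg _)⟩
  · refine ⟨-q, ?_⟩
    rw [norm_sub_tau_neg, norm_neg]
    exact bound (min_le_right _ _) hr (norm_nonneg _)

/-- Composing near-optimal translations through an intermediate function. -/
lemma mob_le_of_mob_lt (hmono : MonotoneOn φ (Set.Ici 0)) (hφ : ∀ a : ℝ, 0 ≤ a → a ≤ φ a)
    (hdouble : ∀ a b : ℝ, 0 ≤ a → 0 ≤ b → b ≤ 2 * a → φ b ≤ 4 * φ a)
    {v0 v1 v2 : Lp ℝ 2 (volume : Measure (EuclideanSpace ℝ (Fin d)))} {m n : ℝ}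
    (hm : mob φ v0 v2 < m) (hn : mob φ v2 v1 < n) :
    mob φ v0 v1 ≤ 5 * (m + n) := by
  obtain ⟨p, hp, hpc⟩ := exists_tau_of_mob_lt hmono hm
  obtain ⟨q, hq, hqc⟩ := exists_tau_of_mob_lt hmono hn
  have hm0 : 0 < m := (Real.sqrt_nonneg _).trans_lt hm
  have hn0 : 0 < n := (Real.sqrt_nonneg _).trans_lt hn
  have h0 := norm_nonneg v0
  have h1 := norm_nonneg v1
  have h2 := norm_nonneg v2
  have hmin : 0 ≤ min ‖v0‖ ‖v1‖ := le_min h0 h1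
  rcases le_or_gt (min ‖v0‖ ‖v1‖) (2 * ‖v2‖) with h | h
  · have hdist : ‖v1 - tau (q + p) v0‖ ≤ n + m := by
      have hsplit : v1 - tau (q + p) v0 = (v1 - tau q v2) + tau q (v2 - tau p v0) := by
        rw [tau_sub, tau_tau]; abel
      rw [hsplit]
      refine (norm_add_le _ _).trans ?_
      rw [norm_tau]
      exact add_le_add hq hp
    have hφp : φ (min ‖v0‖ ‖v1‖) ≤ 4 * φ (min ‖v0‖ ‖v2‖) := by
      refine hdouble _ _ (le_min h0 h2) hmin ?_
      rw [mul_min_of_nonneg _ _ zero_le_two]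
      exact le_min ((min_le_left _ _).trans (by linarith)) h
    have hφq : φ (min ‖v0‖ ‖v1‖) ≤ 4 * φ (min ‖v2‖ ‖v1‖) := by
      refine hdouble _ _ (le_min h2 h1) hmin ?_
      rw [mul_min_of_nonneg _ _ zero_le_two]
      exact le_min h ((min_le_right _ _).trans (by linarith))
    have hcost : ‖q + p‖ * φ (min ‖v0‖ ‖v1‖) ≤ 4 * n + 4 * m := by
      calc ‖q + p‖ * φ (min ‖v0‖ ‖v1‖)
          ≤ (‖q‖ + ‖p‖) * φ (min ‖v0‖ ‖v1‖) :=
            mul_le_mul_of_nonneg_right (norm_add_le _ _) (hmin.trans (hφ _ hmin))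
        _ ≤ ‖q‖ * (4 * φ (min ‖v2‖ ‖v1‖)) + ‖p‖ * (4 * φ (min ‖v0‖ ‖v2‖)) := by
            rw [add_mul]; gcongr
        _ ≤ 4 * n + 4 * m := by linarith
    linarith [mob_le hφ v0 v1 (q + p)]
  · have hle := mob_le hφ v0 v1 0
    rw [tau_zero, norm_zero, zero_mul, add_zero] at hle
    have hp' : ‖v0‖ - ‖v2‖ ≤ m := by
      rw [← norm_tau p v0]
      exact (norm_sub_norm_le _ _).trans ((norm_sub_rev _ _).trans_le hp)
    have hq' : ‖v1‖ - ‖v2‖ ≤ n := by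
      rw [← norm_tau q v2]
      exact (norm_sub_norm_le _ _).trans hq
    linarith [norm_sub_le v1 v0, min_le_left ‖v0‖ ‖v1‖, min_le_right ‖v0‖ ‖v1‖]

end MobileDistance

/-- **Quasi-triangle inequality for the mobile distance**: there is a constant `C ≥ 1`,
depending at most on the dimension `d` and independent of the cut-off function `φ`,
such that `m_φ(v⁰, v¹) ≤ C (m_φ(v⁰, v²) + m_φ(v², v¹))` for all `v⁰, v¹, v² ∈ L²`. -/
theorem mob_quasi_triangle {d : ℕ} (hd : 0 < d) :
    ∃ C : ℝ, 1 ≤ C ∧ ∀ φ : ℝ → ℝ,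
      ContinuousOn φ (Set.Ici 0) → MonotoneOn φ (Set.Ici 0) →
      (∀ a : ℝ, 0 ≤ a → a ≤ φ a) →
      (∀ a b : ℝ, 0 ≤ a → 0 ≤ b → b ≤ 2 * a → φ b ≤ 4 * φ a) →
      ∀ v0 v1 v2 : Lp ℝ 2 (volume : Measure (EuclideanSpace ℝ (Fin d))),
        mob φ v0 v1 ≤ C * (mob φ v0 v2 + mob φ v2 v1) := by
  refine ⟨5, by norm_num, fun φ _ hmono hφ hdouble v0 v1 v2 => ?_⟩
  refine le_of_forall_pos_le_add fun ε hε => ?_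
  linarith [mob_le_of_mob_lt hmono hφ hdouble
    (lt_add_of_pos_right (mob φ v0 v2) (show 0 < ε / 10 by positivity))
    (lt_add_of_pos_right (mob φ v2 v1) (show 0 < ε / 10 by positivity))]
end

section
/- Weak (dual) control of differences by the mobile distance: there is a universal constant C > 0 (one may take C = 4) such that for all v⁰, v¹ ∈ L² and every Schwartz function g : ℝ^d → ℝ, |∫_{ℝ^d} (v⁰(x) − v¹(x)) g(x) dx| ≤ C m_φ(v⁰, v¹) (‖g‖₂ + ‖∇g‖₂), where ‖∇g‖₂ denotes the L² norm of the gradient of g. -/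
open MeasureTheory Filter

/-- The square of the mean of a continuous function on `[0, 1]` is at most the mean of its
square. -/
theorem sq_intervalIntegral_le {f : ℝ → ℝ} (hf : Continuous f) :
    (∫ t in (0 : ℝ)..1, f t) ^ 2 ≤ ∫ t in (0 : ℝ)..1, f t ^ 2 := by
  set c := ∫ t in (0 : ℝ)..1, f t with hc
  have h0 : 0 ≤ ∫ t in (0 : ℝ)..1, (f t - c) ^ 2 :=
    intervalIntegral.integral_nonneg zero_le_one fun t _ => sq_nonneg _
  have h1 : ∫ t in (0 : ℝ)..1, (f t - c) ^ 2 = (∫ t in (0 : ℝ)..1, f t ^ 2) - c ^ 2 := by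
    have h2 : ∀ t, (f t - c) ^ 2 = f t ^ 2 - (2 * c) * f t + c ^ 2 := fun t => by ring
    simp_rw [h2]
    rw [intervalIntegral.integral_add (Continuous.intervalIntegrable (by fun_prop) _ _)
        (Continuous.intervalIntegrable (by fun_prop) _ _),
      intervalIntegral.integral_sub (Continuous.intervalIntegrable (by fun_prop) _ _)
        (Continuous.intervalIntegrable (by fun_prop) _ _),
      intervalIntegral.integral_const_mul, ← hc]
    simp
    ring
  linarith

/-- The squared increment of a `C¹` function along a segment is controlled by the mean of the
squared norm of its derivative on that segment. -/
theorem sq_sub_le_intervalIntegral_fderiv {E : Type*} [NormedAddCommGroup E] [NormedSpace ℝ E]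
    {g : E → ℝ} (hg : ContDiff ℝ 1 g) (q x : E) :
    (g (x + q) - g x) ^ 2 ≤ ∫ t in (0 : ℝ)..1, ‖q‖ ^ 2 * ‖fderiv ℝ g (x + t • q)‖ ^ 2 := by
  have hD : Continuous (fderiv ℝ g) := hg.continuous_fderiv one_ne_zero
  have hderiv : ∀ t : ℝ,
      HasDerivAt (fun t : ℝ => g (x + t • q)) (fderiv ℝ g (x + t • q) q) t := fun t => by
    have h1 : HasDerivAt (fun t : ℝ => x + t • q) q t := by
      simpa using ((hasDerivAt_id t).smul_const q).const_add x
    exact ((hg.differentiable one_ne_zero) (x + t • q)).hasFDerivAt.comp_hasDerivAt t h1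
  have hcont : Continuous fun t : ℝ => fderiv ℝ g (x + t • q) q := by fun_prop
  have hftc : ∫ t in (0 : ℝ)..1, fderiv ℝ g (x + t • q) q = g (x + q) - g x := by
    rw [intervalIntegral.integral_eq_sub_of_hasDerivAt (fun t _ => hderiv t)
      (hcont.intervalIntegrable _ _)]
    simp
  rw [← hftc]
  refine (sq_intervalIntegral_le hcont).trans ?_
  refine intervalIntegral.integral_mono_on zero_le_one
    (Continuous.intervalIntegrable (by fun_prop) _ _)
    (Continuous.intervalIntegrable (by fun_prop) _ _) fun t _ => ?_
  rw [← mul_pow, ← sq_abs, mul_comm, ← Real.norm_eq_abs]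
  gcongr
  exact ContinuousLinearMap.le_opNorm _ _

/-- Translating by `q` changes a Schwartz function by at most `‖q‖ ‖∇g‖₂` in `L²`. -/
theorem integral_sq_translate_sub_le {d : ℕ} (g : SchwartzMap (EuclideanSpace ℝ (Fin d)) ℝ)
    (q : EuclideanSpace ℝ (Fin d)) :
    ∫ x, (g (x + q) - g x) ^ 2 ≤ ‖q‖ ^ 2 * ∫ x, ‖fderiv ℝ g x‖ ^ 2 := by
  have hg : ContDiff ℝ 1 g := g.smooth 1
  have hgc : Continuous g := g.continuous
  have hD : Continuous (fderiv ℝ g) := hg.continuous_fderiv one_ne_zero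
  have hint : Integrable fun x => ‖fderiv ℝ g x‖ ^ 2 :=
    (((SchwartzMap.fderivCLM ℝ (EuclideanSpace ℝ (Fin d)) ℝ g).memLp 2 volume).integrable_norm_pow
      two_ne_zero)
  rw [← integral_const_mul, integral_eq_lintegral_of_nonneg_ae (ae_of_all _ fun x => by positivity)
      (Continuous.aestronglyMeasurable (by fun_prop)),
    integral_eq_lintegral_of_nonneg_ae (ae_of_all _ fun x => by positivity)
      (hint.const_mul _).aestronglyMeasurable]
  refine ENNReal.toReal_mono (hint.const_mul _).lintegral_lt_top.ne ?_
  calc ∫⁻ x, ENNReal.ofReal ((g (x + q) - g x) ^ 2)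
      ≤ ∫⁻ x, ∫⁻ t in Set.Ioc (0 : ℝ) 1,
          ENNReal.ofReal (‖q‖ ^ 2 * ‖fderiv ℝ g (x + t • q)‖ ^ 2) := by
        refine lintegral_mono fun x => ?_
        rw [← ofReal_integral_eq_lintegral_ofReal _ (ae_of_all _ fun t => by positivity),
          ← intervalIntegral.integral_of_le zero_le_one]
        · exact ENNReal.ofReal_le_ofReal (sq_sub_le_intervalIntegral_fderiv hg q x)
        · exact (intervalIntegrable_iff_integrableOn_Ioc_of_le zero_le_one).1
            (Continuous.intervalIntegrable (by fun_prop) _ _)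
    _ = ∫⁻ t in Set.Ioc (0 : ℝ) 1, ∫⁻ x,
          ENNReal.ofReal (‖q‖ ^ 2 * ‖fderiv ℝ g (x + t • q)‖ ^ 2) := by
        refine lintegral_lintegral_swap (Measurable.aemeasurable ?_)
        exact (ENNReal.continuous_ofReal.comp (by fun_prop :
          Continuous fun p : EuclideanSpace ℝ (Fin d) × ℝ =>
            ‖q‖ ^ 2 * ‖fderiv ℝ g (p.1 + p.2 • q)‖ ^ 2)).measurable
    _ = ∫⁻ x, ENNReal.ofReal (‖q‖ ^ 2 * ‖fderiv ℝ g x‖ ^ 2) := by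
        simp_rw [fun t : ℝ => lintegral_add_right_eq_self (μ := volume)
          (fun x => ENNReal.ofReal (‖q‖ ^ 2 * ‖fderiv ℝ g x‖ ^ 2)) (t • q)]
        simp

/-- The Cauchy-Schwarz inequality in `L²`. -/
theorem abs_integral_mul_le_norm_mul_sqrt {α : Type*} [MeasurableSpace α] {μ : Measure α}
    (v : Lp ℝ 2 μ) {h : α → ℝ} (hh : MemLp h 2 μ) :
    |∫ x, v x * h x ∂μ| ≤ ‖v‖ * Real.sqrt (∫ x, h x ^ 2 ∂μ) := by
  have inner_toLp : ∀ u : Lp ℝ 2 μ, inner ℝ u (hh.toLp h) = ∫ x, u x * h x ∂μ := fun u => by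
    rw [L2.inner_def]
    refine integral_congr_ae ?_
    filter_upwards [hh.coeFn_toLp] with x hx
    simp [hx, mul_comm]
  have norm_toLp : ‖hh.toLp h‖ = Real.sqrt (∫ x, h x ^ 2 ∂μ) := by
    rw [norm_eq_sqrt_real_inner, inner_toLp]
    congr 1
    refine integral_congr_ae ?_
    filter_upwards [hh.coeFn_toLp] with x hx
    rw [hx, sq]
  rw [← inner_toLp, ← norm_toLp]
  exact abs_real_inner_le_norm _ _

theorem integral_tau_mul {d : ℕ} (q : EuclideanSpace ℝ (Fin d))
    (v : Lp ℝ 2 (volume : Measure (EuclideanSpace ℝ (Fin d))))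
    (g : EuclideanSpace ℝ (Fin d) → ℝ) :
    ∫ x, tau q v x * g x = ∫ x, v x * g (x + q) := by
  rw [← integral_sub_right_eq_self (fun x => v x * g (x + q)) q]
  refine integral_congr_ae ?_
  filter_upwards [Lp.coeFn_compMeasurePreserving v (measurePreserving_sub_right volume q)]
    with x hx
  rw [tau, hx, Function.comp_apply, sub_add_cancel]

/-- Control of `∫ (w - v) g` by one competitor in the definition of the mobile distance. -/
theorem sq_integral_sub_mul_le {d : ℕ} {b : ℝ}
    (v w : Lp ℝ 2 (volume : Measure (EuclideanSpace ℝ (Fin d)))) (hb : ‖v‖ ≤ b)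
    (g : SchwartzMap (EuclideanSpace ℝ (Fin d)) ℝ) (q : EuclideanSpace ℝ (Fin d)) :
    (∫ x, (w x - v x) * g x) ^ 2 ≤ (‖w - tau q v‖ ^ 2 + ‖q‖ ^ 2 * b ^ 2) *
      (Real.sqrt (∫ x, g x ^ 2) + Real.sqrt (∫ x, ‖fderiv ℝ g x‖ ^ 2)) ^ 2 := by
  have hg : MemLp g 2 := g.memLp 2 volume
  have hgq : MemLp (fun x => g (x + q)) 2 :=
    hg.comp_measurePreserving (measurePreserving_add_right volume q)
  have hint : ∀ (u : Lp ℝ 2 (volume : Measure (EuclideanSpace ℝ (Fin d))))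
      {h : EuclideanSpace ℝ (Fin d) → ℝ}, MemLp h 2 → Integrable fun x => u x * h x :=
    fun u h hh => (Lp.memLp u).integrable_mul hh
  have hsplit : ∫ x, (w x - v x) * g x =
      (∫ x, (w - tau q v) x * g x) + ∫ x, v x * (g (x + q) - g x) := by
    have h1 : ∫ x, (w - tau q v) x * g x = (∫ x, w x * g x) - ∫ x, v x * g (x + q) := by
      rw [← integral_tau_mul, ← integral_sub (hint w hg) (hint _ hg)]
      refine integral_congr_ae ?_
      filter_upwards [Lp.coeFn_sub w (tau q v)] with x hx
      rw [hx, Pi.sub_apply, sub_mul]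
    simp_rw [h1, mul_sub, sub_mul]
    rw [integral_sub (hint w hg) (hint v hg), integral_sub (hint v hgq) (hint v hg)]
    ring
  have h1 := abs_integral_mul_le_norm_mul_sqrt (w - tau q v) hg
  have h2 := abs_integral_mul_le_norm_mul_sqrt v (hgq.sub hg)
  simp only [Pi.sub_apply] at h2
  set G := Real.sqrt (∫ x, g x ^ 2)
  set D := Real.sqrt (∫ x, ‖fderiv ℝ g x‖ ^ 2)
  have hG : 0 ≤ G := Real.sqrt_nonneg _
  have hb0 : 0 ≤ b := (norm_nonneg v).trans hb
  have hD : 0 ≤ D := Real.sqrt_nonneg _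
  have h3 : Real.sqrt (∫ x, (g (x + q) - g x) ^ 2) ≤ ‖q‖ * D := by
    refine (Real.sqrt_le_sqrt (integral_sq_translate_sub_le g q)).trans_eq ?_
    rw [Real.sqrt_mul (sq_nonneg _), Real.sqrt_sq (norm_nonneg _)]
  have h4 : ‖v‖ * Real.sqrt (∫ x, (g (x + q) - g x) ^ 2) ≤ b * (‖q‖ * D) := by gcongr
  set R := Real.sqrt (‖w - tau q v‖ ^ 2 + ‖q‖ ^ 2 * b ^ 2)
  have hR1 : ‖w - tau q v‖ ≤ R := Real.le_sqrt_of_sq_le (le_add_of_nonneg_right (by positivity))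
  have hR2 : b * ‖q‖ ≤ R := Real.le_sqrt_of_sq_le (by
    rw [mul_pow, mul_comm]; exact le_add_of_nonneg_left (sq_nonneg _))
  have hle : |∫ x, (w x - v x) * g x| ≤ R * (G + D) := by
    rw [hsplit]
    calc _ ≤ ‖w - tau q v‖ * G + b * (‖q‖ * D) :=
          (abs_add_le _ _).trans (add_le_add h1 (h2.trans h4))
      _ = ‖w - tau q v‖ * G + b * ‖q‖ * D := by ring
      _ ≤ R * G + R * D := by gcongr
      _ = R * (G + D) := by ring
  rw [← sq_abs, ← Real.sq_sqrt (show 0 ≤ ‖w - tau q v‖ ^ 2 + ‖q‖ ^ 2 * b ^ 2 by positivity),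
    ← mul_pow]
  exact pow_le_pow_left₀ (abs_nonneg _) hle 2

/-- **Weak (dual) control of differences by the mobile distance**: there is a universal
constant `C > 0` (one may take `C = 4`) such that for all `v⁰, v¹ ∈ L²(ℝ^d)` and every
Schwartz function `g : ℝ^d → ℝ`,
`|∫ (v⁰ − v¹) g| ≤ C m_φ(v⁰, v¹) (‖g‖₂ + ‖∇g‖₂)`. -/
theorem mob_weak_dual_control :
    ∃ C : ℝ, 0 < C ∧ ∀ (d : ℕ), 0 < d → ∀ φ : ℝ → ℝ,
      ContinuousOn φ (Set.Ici 0) → MonotoneOn φ (Set.Ici 0) →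
      (∀ a : ℝ, 0 ≤ a → a ≤ φ a) →
      (∀ a b : ℝ, 0 ≤ a → 0 ≤ b → b ≤ 2 * a → φ b ≤ 4 * φ a) →
      ∀ (v0 v1 : Lp ℝ 2 (volume : Measure (EuclideanSpace ℝ (Fin d))))
        (g : SchwartzMap (EuclideanSpace ℝ (Fin d)) ℝ),
        |∫ x : EuclideanSpace ℝ (Fin d), (v0 x - v1 x) * g x| ≤
          C * mob φ v0 v1 *
            (Real.sqrt (∫ x : EuclideanSpace ℝ (Fin d), g x ^ 2) +
              Real.sqrt (∫ x : EuclideanSpace ℝ (Fin d), ‖fderiv ℝ g x‖ ^ 2)) := by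
  refine ⟨1, one_pos, fun d _ φ _ _ hφ _ v0 v1 g => ?_⟩
  set N := Real.sqrt (∫ x, g x ^ 2) + Real.sqrt (∫ x, ‖fderiv ℝ g x‖ ^ 2)
  set I := ∫ x, (v0 x - v1 x) * g x with hI
  have hN : 0 ≤ N := by positivity
  have hbound : ∀ r ∈ {r : ℝ | ∃ q : EuclideanSpace ℝ (Fin d),
      r = ‖v1 - tau q v0‖ ^ 2 + ‖q‖ ^ 2 * φ ‖v0‖ ^ 2 ∨
      r = ‖v0 - tau q v1‖ ^ 2 + ‖q‖ ^ 2 * φ ‖v1‖ ^ 2}, I ^ 2 ≤ r * N ^ 2 := by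
    rintro r ⟨q, rfl | rfl⟩
    · have hneg : I = -∫ x, (v1 x - v0 x) * g x := by
        rw [hI, ← integral_neg]
        congr 1 with x
        ring
      rw [hneg, neg_sq]
      exact sq_integral_sub_mul_le v0 v1 (hφ _ (norm_nonneg _)) g q
    · exact sq_integral_sub_mul_le v1 v0 (hφ _ (norm_nonneg _)) g q
  rw [one_mul]
  rcases hN.eq_or_lt with hN0 | hNpos
  · have h := hbound _ ⟨0, Or.inl rfl⟩
    rw [← hN0] at h ⊢
    have hI0 : I = 0 := by
      rw [zero_pow two_ne_zero, mul_zero] at h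
      exact pow_eq_zero_iff two_ne_zero |>.1 (le_antisymm h (sq_nonneg _))
    simp [hI0]
  · have hinf : (|I| / N) ^ 2 ≤ mobSq φ v0 v1 := by
      refine le_csInf ⟨_, 0, Or.inl rfl⟩ fun r hr => ?_
      rw [div_pow, sq_abs, div_le_iff₀ (by positivity)]
      exact hbound r hr
    exact (div_le_iff₀ hNpos).1 (Real.le_sqrt_of_sq_le hinf)
end

section
/- Completeness of the space of mobile-Lipschitz graphs: let F be a real Banach space and ℓ ≥ 0, and let 𝒢 be the set of maps G : L² → F with G(0) = 0 and ‖G(u) − G(v)‖_F ≤ ℓ m_φ(u, v) for all u, v ∈ L². Then (i) every G ∈ 𝒢 satisfies ‖G(ψ)‖_F ≤ ℓ ‖ψ‖₂ for all ψ ∈ L², so ρ(G, H) := sup_{ψ ≠ 0} ‖G(ψ) − H(ψ)‖_F / ‖ψ‖₂ is finite for G, H ∈ 𝒢; and (ii) 𝒢 is a complete metric space with respect to ρ. -/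
open MeasureTheory Filter

noncomputable section

/-- `G` is a mobile-Lipschitz graph map with constant `ℓ`: `G 0 = 0` and
`‖G u − G v‖ ≤ ℓ m_φ(u, v)` for all `u, v`. -/
def IsMobileLipGraph {d : ℕ} {F : Type*} [NormedAddCommGroup F] (φ : ℝ → ℝ) (ℓ : ℝ)
    (G : Lp ℝ 2 (volume : Measure (EuclideanSpace ℝ (Fin d))) → F) : Prop :=
  G 0 = 0 ∧ ∀ u v : Lp ℝ 2 (volume : Measure (EuclideanSpace ℝ (Fin d))),
    ‖G u - G v‖ ≤ ℓ * mob φ u v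

/-- The distance `ρ(G, H) = sup_{ψ ≠ 0} ‖G ψ − H ψ‖ / ‖ψ‖₂` on graph maps. -/
def graphDist {d : ℕ} {F : Type*} [NormedAddCommGroup F]
    (G H : Lp ℝ 2 (volume : Measure (EuclideanSpace ℝ (Fin d))) → F) : ℝ :=
  ⨆ ψ : {ψ : Lp ℝ 2 (volume : Measure (EuclideanSpace ℝ (Fin d))) // ψ ≠ 0},
    ‖G ψ.1 - H ψ.1‖ / ‖ψ.1‖

end

theorem tau_zero_right {d : ℕ} (q : EuclideanSpace ℝ (Fin d)) :
    tau q (0 : Lp ℝ 2 (volume : Measure (EuclideanSpace ℝ (Fin d)))) = 0 :=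
  map_zero _

theorem mobSq_zero_right_le {d : ℕ} (φ : ℝ → ℝ)
    (ψ : Lp ℝ 2 (volume : Measure (EuclideanSpace ℝ (Fin d)))) :
    mobSq φ ψ 0 ≤ ‖ψ‖ ^ 2 := by
  refine csInf_le ⟨0, ?_⟩ ⟨0, Or.inr ?_⟩
  · rintro r ⟨q, rfl | rfl⟩ <;> positivity
  · simp [tau_zero_right]

theorem mob_zero_right_le {d : ℕ} (φ : ℝ → ℝ)
    (ψ : Lp ℝ 2 (volume : Measure (EuclideanSpace ℝ (Fin d)))) :
    mob φ ψ 0 ≤ ‖ψ‖ :=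
  Real.sqrt_le_iff.2 ⟨norm_nonneg ψ, mobSq_zero_right_le φ ψ⟩

theorem graphDist_nonneg {d : ℕ} {F : Type*} [NormedAddCommGroup F]
    (G H : Lp ℝ 2 (volume : Measure (EuclideanSpace ℝ (Fin d))) → F) :
    0 ≤ graphDist G H :=
  Real.iSup_nonneg fun _ => by positivity

theorem graphDist_le {d : ℕ} {F : Type*} [NormedAddCommGroup F]
    {G H : Lp ℝ 2 (volume : Measure (EuclideanSpace ℝ (Fin d))) → F} {C : ℝ} (hC : 0 ≤ C)
    (h : ∀ ψ, ‖G ψ - H ψ‖ ≤ C * ‖ψ‖) : graphDist G H ≤ C :=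
  Real.iSup_le (fun ψ => div_le_of_le_mul₀ (norm_nonneg _) hC (h ψ.1)) hC

namespace IsMobileLipGraph

variable {d : ℕ} {F : Type*} [NormedAddCommGroup F] {φ : ℝ → ℝ} {ℓ : ℝ}
  {G H : Lp ℝ 2 (volume : Measure (EuclideanSpace ℝ (Fin d))) → F}

theorem norm_apply_le (hG : IsMobileLipGraph φ ℓ G) (hℓ : 0 ≤ ℓ)
    (ψ : Lp ℝ 2 (volume : Measure (EuclideanSpace ℝ (Fin d)))) : ‖G ψ‖ ≤ ℓ * ‖ψ‖ := by
  have h := hG.2 ψ 0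
  rw [hG.1, sub_zero] at h
  exact h.trans (mul_le_mul_of_nonneg_left (mob_zero_right_le φ ψ) hℓ)

theorem norm_sub_div_le (hG : IsMobileLipGraph φ ℓ G) (hH : IsMobileLipGraph φ ℓ H)
    (hℓ : 0 ≤ ℓ) (ψ : Lp ℝ 2 (volume : Measure (EuclideanSpace ℝ (Fin d)))) :
    ‖G ψ - H ψ‖ / ‖ψ‖ ≤ 2 * ℓ := by
  refine div_le_of_le_mul₀ (norm_nonneg _) (by positivity) ?_
  linarith [norm_sub_le (G ψ) (H ψ), hG.norm_apply_le hℓ ψ, hH.norm_apply_le hℓ ψ]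

theorem norm_sub_le_graphDist_mul (hG : IsMobileLipGraph φ ℓ G)
    (hH : IsMobileLipGraph φ ℓ H) (hℓ : 0 ≤ ℓ)
    (ψ : Lp ℝ 2 (volume : Measure (EuclideanSpace ℝ (Fin d)))) :
    ‖G ψ - H ψ‖ ≤ graphDist G H * ‖ψ‖ := by
  rcases eq_or_ne ψ 0 with rfl | hψ
  · simp [hG.1, hH.1]
  · rw [← div_le_iff₀ (norm_pos_iff.2 hψ)]
    exact le_ciSup (f := fun ψ : {ψ : Lp ℝ 2 (volume : Measure (EuclideanSpace ℝ (Fin d))) //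
      ψ ≠ 0} => ‖G ψ.1 - H ψ.1‖ / ‖ψ.1‖)
      ⟨2 * ℓ, by rintro _ ⟨ψ, rfl⟩; exact hG.norm_sub_div_le hH hℓ ψ.1⟩ ⟨ψ, hψ⟩

theorem of_tendsto {Gs : ℕ → Lp ℝ 2 (volume : Measure (EuclideanSpace ℝ (Fin d))) → F}
    (hGs : ∀ n, IsMobileLipGraph φ ℓ (Gs n))
    (hG : ∀ ψ, Tendsto (fun n => Gs n ψ) atTop (nhds (G ψ))) : IsMobileLipGraph φ ℓ G :=
  ⟨tendsto_nhds_unique (hG 0) (by simp [(hGs _).1]), fun u v =>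
    le_of_tendsto ((hG u).sub (hG v)).norm (Eventually.of_forall fun n => (hGs n).2 u v)⟩

end IsMobileLipGraph

/-- **Completeness of the space of mobile-Lipschitz graphs**: (i) every `G` in the class
`𝒢` of mobile-Lipschitz maps with constant `ℓ` satisfies `‖G ψ‖ ≤ ℓ ‖ψ‖₂`, so the set of
quotients defining `ρ(G, H)` is bounded above (i.e. `ρ(G,H)` is finite) for `G, H ∈ 𝒢`;
and (ii) `𝒢` is complete with respect to `ρ`: every `ρ`-Cauchy sequence in `𝒢`
`ρ`-converges to some member of `𝒢`. -/
theorem mobile_lip_graphs_complete {d : ℕ} (hd : 0 < d) (φ : ℝ → ℝ)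
    (hφc : ContinuousOn φ (Set.Ici 0)) (hφm : MonotoneOn φ (Set.Ici 0))
    (hφ1 : ∀ a : ℝ, 0 ≤ a → a ≤ φ a)
    (hφ4 : ∀ a b : ℝ, 0 ≤ a → 0 ≤ b → b ≤ 2 * a → φ b ≤ 4 * φ a)
    {F : Type*} [NormedAddCommGroup F] [NormedSpace ℝ F] [CompleteSpace F]
    (ℓ : ℝ) (hℓ : 0 ≤ ℓ) :
    (∀ G : Lp ℝ 2 (volume : Measure (EuclideanSpace ℝ (Fin d))) → F,
        IsMobileLipGraph φ ℓ G →
        ∀ ψ : Lp ℝ 2 (volume : Measure (EuclideanSpace ℝ (Fin d))), ‖G ψ‖ ≤ ℓ * ‖ψ‖) ∧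
    (∀ G H : Lp ℝ 2 (volume : Measure (EuclideanSpace ℝ (Fin d))) → F,
        IsMobileLipGraph φ ℓ G → IsMobileLipGraph φ ℓ H →
        BddAbove {r : ℝ | ∃ ψ : Lp ℝ 2 (volume : Measure (EuclideanSpace ℝ (Fin d))),
          ψ ≠ 0 ∧ r = ‖G ψ - H ψ‖ / ‖ψ‖}) ∧
    (∀ Gs : ℕ → (Lp ℝ 2 (volume : Measure (EuclideanSpace ℝ (Fin d))) → F),
        (∀ n, IsMobileLipGraph φ ℓ (Gs n)) →
        (∀ ε : ℝ, 0 < ε → ∃ N : ℕ, ∀ m n : ℕ, N ≤ m → N ≤ n →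
          graphDist (Gs m) (Gs n) < ε) →
        ∃ G : Lp ℝ 2 (volume : Measure (EuclideanSpace ℝ (Fin d))) → F,
          IsMobileLipGraph φ ℓ G ∧
          Tendsto (fun n => graphDist (Gs n) G) atTop (nhds 0)) := by
  refine ⟨fun G hG => hG.norm_apply_le hℓ, fun G H hG hH => ⟨2 * ℓ, ?_⟩, fun Gs hGs hC => ?_⟩
  · rintro _ ⟨ψ, -, rfl⟩
    exact hG.norm_sub_div_le hH hℓ ψ
  have hcauchy : ∀ ε : ℝ, 0 < ε → ∃ N : ℕ, ∀ m n : ℕ, N ≤ m → N ≤ n →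
      ∀ ψ, ‖Gs m ψ - Gs n ψ‖ ≤ ε * ‖ψ‖ := by
    intro ε hε
    obtain ⟨N, hN⟩ := hC ε hε
    exact ⟨N, fun m n hm hn ψ => ((hGs m).norm_sub_le_graphDist_mul (hGs n) hℓ ψ).trans
      (mul_le_mul_of_nonneg_right (hN m n hm hn).le (norm_nonneg ψ))⟩
  have hlim : ∀ ψ, ∃ y, Tendsto (fun n => Gs n ψ) atTop (nhds y) := by
    intro ψ
    refine cauchySeq_tendsto_of_complete (Metric.cauchySeq_iff.2 fun ε hε => ?_)
    have hψ : 0 < ‖ψ‖ + 1 := by positivity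
    obtain ⟨N, hN⟩ := hcauchy (ε / (‖ψ‖ + 1)) (by positivity)
    refine ⟨N, fun m hm n hn => ?_⟩
    rw [dist_eq_norm]
    refine (hN m n hm hn ψ).trans_lt ?_
    rw [div_mul_eq_mul_div, div_lt_iff₀ hψ]
    linarith
  choose G hG using hlim
  refine ⟨G, .of_tendsto hGs hG, Metric.tendsto_atTop.2 fun ε hε => ?_⟩
  obtain ⟨N, hN⟩ := hcauchy (ε / 2) (half_pos hε)
  refine ⟨N, fun n hn => ?_⟩
  rw [Real.dist_0_eq_abs, abs_of_nonneg (graphDist_nonneg _ _)]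
  refine (graphDist_le (half_pos hε).le fun ψ => ?_).trans_lt (half_lt_self hε)
  exact le_of_tendsto ((hG ψ).const_sub (Gs n ψ)).norm
    ((eventually_ge_atTop N).mono fun m hm => hN n m hn hm ψ)
end

section
/- Bound on the mobile derivative of a mobile-Lipschitz map: let F be a real normed space, ℓ ≥ 0, and let G : L² → F satisfy ‖G(u) − G(v)‖_F ≤ ℓ m_φ(u, v) for all u, v ∈ L². If G is mobile-differentiable at a point φ₀ ∈ L² with mobile derivative M, then ‖M(ψ, q)‖_F ≤ ℓ (‖ψ‖₂ + |q| φ(‖φ₀‖₂)) for all ψ ∈ L² and q ∈ ℝ^d. -/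
open MeasureTheory Filter

theorem norm_tau_sub_tau {d : ℕ} (q : EuclideanSpace ℝ (Fin d))
    (v w : Lp ℝ 2 (volume : Measure (EuclideanSpace ℝ (Fin d)))) :
    ‖tau q v - tau q w‖ = ‖v - w‖ := by
  unfold tau
  rw [← map_sub, Lp.norm_compMeasurePreserving]

theorem mob_le_norm_sub_tau_add {d : ℕ} {φ : ℝ → ℝ}
    (u v : Lp ℝ 2 (volume : Measure (EuclideanSpace ℝ (Fin d)))) (hv : 0 ≤ φ ‖v‖)
    (q : EuclideanSpace ℝ (Fin d)) :
    mob φ u v ≤ ‖u - tau q v‖ + ‖q‖ * φ ‖v‖ := by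
  have hq : 0 ≤ ‖q‖ * φ ‖v‖ := by positivity
  have hsq : mobSq φ u v ≤ ‖u - tau q v‖ ^ 2 + ‖q‖ ^ 2 * φ ‖v‖ ^ 2 := by
    refine csInf_le ⟨0, ?_⟩ ⟨q, Or.inr rfl⟩
    rintro r ⟨p, rfl | rfl⟩ <;> positivity
  refine Real.sqrt_le_iff.mpr ⟨by positivity, hsq.trans ?_⟩
  nlinarith [mul_nonneg (norm_nonneg (u - tau q v)) hq]

/-- **Bound on the mobile derivative of a mobile-Lipschitz map**: if `G : L² → F` is
mobile-Lipschitz with constant `ℓ` (w.r.t. the mobile distance `m_φ`) and is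
mobile-differentiable at `φ₀` with mobile derivative `M`, i.e.
`‖G((φ₀+εψ)(·+εq)) − G(φ₀) − ε M(ψ,q)‖/|ε| → 0` as `ε → 0` for all `(ψ, q)`, then
`‖M(ψ, q)‖ ≤ ℓ (‖ψ‖₂ + |q| φ(‖φ₀‖₂))`. -/
theorem mobile_derivative_bound {d : ℕ} (hd : 0 < d) (φ : ℝ → ℝ)
    (hφc : ContinuousOn φ (Set.Ici 0)) (hφm : MonotoneOn φ (Set.Ici 0))
    (hφ1 : ∀ a : ℝ, 0 ≤ a → a ≤ φ a)
    (hφ4 : ∀ a b : ℝ, 0 ≤ a → 0 ≤ b → b ≤ 2 * a → φ b ≤ 4 * φ a)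
    {F : Type*} [NormedAddCommGroup F] [NormedSpace ℝ F]
    (ℓ : ℝ) (hℓ : 0 ≤ ℓ)
    (G : Lp ℝ 2 (volume : Measure (EuclideanSpace ℝ (Fin d))) → F)
    (hGlip : ∀ u v : Lp ℝ 2 (volume : Measure (EuclideanSpace ℝ (Fin d))),
      ‖G u - G v‖ ≤ ℓ * mob φ u v)
    (φ₀ : Lp ℝ 2 (volume : Measure (EuclideanSpace ℝ (Fin d))))
    (M : (Lp ℝ 2 (volume : Measure (EuclideanSpace ℝ (Fin d))) ×
      EuclideanSpace ℝ (Fin d)) →L[ℝ] F)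
    (hM : ∀ (ψ : Lp ℝ 2 (volume : Measure (EuclideanSpace ℝ (Fin d))))
        (q : EuclideanSpace ℝ (Fin d)),
      Tendsto (fun ε : ℝ =>
          ‖G (tau (-(ε • q)) (φ₀ + ε • ψ)) - G φ₀ - ε • M (ψ, q)‖ / |ε|)
        (nhdsWithin 0 {(0 : ℝ)}ᶜ) (nhds 0)) :
    ∀ (ψ : Lp ℝ 2 (volume : Measure (EuclideanSpace ℝ (Fin d))))
      (q : EuclideanSpace ℝ (Fin d)),
      ‖M (ψ, q)‖ ≤ ℓ * (‖ψ‖ + ‖q‖ * φ ‖φ₀‖) := by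
  intro ψ q
  have hφ₀ : 0 ≤ φ ‖φ₀‖ := (norm_nonneg _).trans (hφ1 _ (norm_nonneg _))
  have hlim := (hM ψ q).add_const (ℓ * (‖ψ‖ + ‖q‖ * φ ‖φ₀‖))
  rw [zero_add] at hlim
  refine ge_of_tendsto hlim ?_
  filter_upwards [self_mem_nhdsWithin] with ε hε
  have hpos : 0 < |ε| := abs_pos.mpr hε
  have hmob : mob φ (tau (-(ε • q)) (φ₀ + ε • ψ)) φ₀ ≤ |ε| * (‖ψ‖ + ‖q‖ * φ ‖φ₀‖) := by
    refine (mob_le_norm_sub_tau_add _ _ hφ₀ (-(ε • q))).trans_eq ?_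
    rw [norm_tau_sub_tau, add_sub_cancel_left, norm_neg, norm_smul, norm_smul, Real.norm_eq_abs]
    ring
  have hG := (hGlip (tau (-(ε • q)) (φ₀ + ε • ψ)) φ₀).trans (mul_le_mul_of_nonneg_left hmob hℓ)
  have htri := norm_sub_norm_le (ε • M (ψ, q)) (G (tau (-(ε • q)) (φ₀ + ε • ψ)) - G φ₀)
  rw [norm_sub_rev (ε • M (ψ, q)), norm_smul, Real.norm_eq_abs] at htri
  rw [← sub_le_iff_le_add, le_div_iff₀ hpos]
  linarith
end

section
/- Closedness of uniformly C^{1,α} families under pointwise limits: let E be a real Banach space, F a real Banach space, α ∈ (0,1] and Λ ≥ 0. For each n ∈ ℕ let G_n : E → F be Fréchet differentiable at every point, with derivatives satisfying the uniform modulus bound ‖DG_n(x) − DG_n(y)‖ ≤ Λ (‖x − y‖^α + ‖x − y‖) for all n and all x, y ∈ E. Suppose G : E → F satisfies G_n(x) → G(x) in F for every x ∈ E. Then G is Fréchet differentiable at every point, its derivative satisfies ‖DG(x) − DG(y)‖ ≤ Λ (‖x − y‖^α + ‖x − y‖) for all x, y, and DG_n(x) h → DG(x) h in F for every x, h ∈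 E. -/
open Filter

/-- First-order Taylor estimate for a map whose derivative has a monotone modulus of
continuity. -/
theorem norm_taylor_remainder_le_of_modulus
    {E F : Type*} [NormedAddCommGroup E] [NormedSpace ℝ E]
    [NormedAddCommGroup F] [NormedSpace ℝ F] {ω : ℝ → ℝ} (hω : MonotoneOn ω (Set.Ici 0))
    {f : E → F} {f' : E → (E →L[ℝ] F)} (hf : ∀ x, HasFDerivAt f (f' x) x)
    (hmod : ∀ x y, ‖f' x - f' y‖ ≤ ω ‖x - y‖) (x h : E) :
    ‖f (x + h) - f x - f' x h‖ ≤ ω ‖h‖ * ‖h‖ := by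
  have key := (convex_closedBall x ‖h‖).norm_image_sub_le_of_norm_hasFDerivWithin_le'
    (f := f) (f' := f') (φ := f' x) (C := ω ‖h‖) (x := x) (y := x + h)
    (fun z _ => (hf z).hasFDerivWithinAt)
    (fun z hz => (hmod z x).trans
      (hω (norm_nonneg _) (norm_nonneg _) (mem_closedBall_iff_norm.1 hz)))
    (Metric.mem_closedBall_self (norm_nonneg _)) (by simp)
  simpa using key

/-- If a family of maps converges pointwise and their derivatives share a modulus of continuity
vanishing at `0`, then the directional derivatives form Cauchy sequences. -/
theorem cauchySeq_fderiv_apply_of_modulus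
    {E F : Type*} [NormedAddCommGroup E] [NormedSpace ℝ E]
    [NormedAddCommGroup F] [NormedSpace ℝ F] {ω : ℝ → ℝ} (hω : MonotoneOn ω (Set.Ici 0))
    (hω0 : Tendsto ω (nhds 0) (nhds 0))
    {G : ℕ → E → F} {G' : ℕ → E → (E →L[ℝ] F)} (hG : ∀ n x, HasFDerivAt (G n) (G' n x) x)
    (hmod : ∀ n x y, ‖G' n x - G' n y‖ ≤ ω ‖x - y‖)
    (hcauchy : ∀ x, CauchySeq fun n => G n x) (x h : E) :
    CauchySeq fun n => G' n x h := by
  have hlim : Tendsto (fun t : ℝ => ω (|t| * ‖h‖) * ‖h‖) (nhdsWithin 0 (Set.Ioi 0))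
      (nhds 0) := by
    have h1 : Tendsto (fun t : ℝ => |t| * ‖h‖) (nhds 0) (nhds 0) := by
      have : Continuous fun t : ℝ => |t| * ‖h‖ := by fun_prop
      simpa using this.tendsto 0
    simpa using ((hω0.comp h1).mul_const ‖h‖).mono_left nhdsWithin_le_nhds
  rw [Metric.cauchySeq_iff']
  intro ε hε
  obtain ⟨t, hte, ht⟩ := ((hlim.eventually (gt_mem_nhds (show (0 : ℝ) < ε / 3 by positivity))).and
    self_mem_nhdsWithin).exists
  have ht : 0 < t := ht
  have happrox : ∀ n, ‖t⁻¹ • (G n (x + t • h) - G n x) - G' n x h‖ < ε / 3 := by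
    intro n
    have h1 := norm_taylor_remainder_le_of_modulus hω (hG n) (hmod n) x (t • h)
    have h2 : t⁻¹ • (G n (x + t • h) - G n x) - G' n x h
        = t⁻¹ • (G n (x + t • h) - G n x - G' n x (t • h)) := by
      rw [map_smul, smul_sub t⁻¹ _ (t • _), inv_smul_smul₀ ht.ne']
    rw [norm_smul, Real.norm_eq_abs] at h1
    rw [h2, norm_smul, norm_inv, Real.norm_eq_abs, inv_mul_lt_iff₀ (abs_pos.2 ht.ne')]
    have := mul_lt_mul_of_pos_left hte (abs_pos.2 ht.ne')
    linarith
  have hquot : CauchySeq fun n => t⁻¹ • (G n (x + t • h) - G n x) := by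
    have h1 : CauchySeq fun n => G n (x + t • h) - G n x := by
      simp only [sub_eq_add_neg]
      exact (hcauchy (x + t • h)).add (hcauchy x).neg
    exact (uniformContinuous_const_smul t⁻¹).comp_cauchySeq h1
  obtain ⟨N, hN⟩ := Metric.cauchySeq_iff'.1 hquot (ε / 3) (by positivity)
  refine ⟨N, fun n hn => ?_⟩
  have h1 := hN n hn
  have h2 := happrox n
  have h3 := happrox N
  rw [← dist_eq_norm] at h2 h3
  rw [dist_comm] at h2
  have := dist_triangle4 (G' n x h) (t⁻¹ • (G n (x + t • h) - G n x))
    (t⁻¹ • (G N (x + t • h) - G N x)) (G' N x h)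
  linarith

/-- **Closedness of uniformly `C^{1,α}` families under pointwise limits**: let `E, F` be
real Banach spaces, `α ∈ (0,1]`, `Λ ≥ 0`, and let `G n : E → F` be everywhere Fréchet
differentiable with derivatives `G' n` satisfying the uniform modulus bound
`‖G' n x − G' n y‖ ≤ Λ (‖x − y‖^α + ‖x − y‖)`.  If `G n → Glim` pointwise, then `Glim`
is everywhere Fréchet differentiable, its derivative satisfies the same modulus bound,
and `G' n x h → DGlim x h` for all `x, h`. -/
theorem c1alpha_closed_under_pointwise_limits
    {E F : Type*} [NormedAddCommGroup E] [NormedSpace ℝ E] [CompleteSpace E]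
    [NormedAddCommGroup F] [NormedSpace ℝ F] [CompleteSpace F]
    (α Λ : ℝ) (hα0 : 0 < α) (hα1 : α ≤ 1) (hΛ : 0 ≤ Λ)
    (G : ℕ → E → F) (G' : ℕ → E → (E →L[ℝ] F))
    (hdiff : ∀ n x, HasFDerivAt (G n) (G' n x) x)
    (hmod : ∀ n x y, ‖G' n x - G' n y‖ ≤ Λ * (‖x - y‖ ^ α + ‖x - y‖))
    (Glim : E → F)
    (hlim : ∀ x, Tendsto (fun n => G n x) atTop (nhds (Glim x))) :
    ∃ D : E → (E →L[ℝ] F),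
      (∀ x, HasFDerivAt Glim (D x) x) ∧
      (∀ x y, ‖D x - D y‖ ≤ Λ * (‖x - y‖ ^ α + ‖x - y‖)) ∧
      (∀ x h, Tendsto (fun n => G' n x h) atTop (nhds (D x h))) := by
  have hω : MonotoneOn (fun r : ℝ => Λ * (r ^ α + r)) (Set.Ici 0) := by
    intro r hr s _ hrs
    have hr : 0 ≤ r := hr
    dsimp only
    gcongr
  have hω0 : Tendsto (fun r : ℝ => Λ * (r ^ α + r)) (nhds 0) (nhds 0) := by
    have : Continuous fun r : ℝ => Λ * (r ^ α + r) :=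
      continuous_const.mul ((Real.continuous_rpow_const hα0.le).add continuous_id)
    simpa [Real.zero_rpow hα0.ne'] using this.tendsto 0
  choose L hL using fun x h => cauchySeq_tendsto_of_complete
    (cauchySeq_fderiv_apply_of_modulus hω hω0 hdiff hmod (fun x => (hlim x).cauchySeq) x h)
  let D : E → (E →L[ℝ] F) := fun x =>
    continuousLinearMapOfTendsto (fun n => G' n x) (tendsto_pi_nhds.2 (hL x))
  have hD : ∀ x h, Tendsto (fun n => G' n x h) atTop (nhds (D x h)) := hL
  refine ⟨D, fun x => ?_, fun x y => ?_, hD⟩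
  · have htaylor : ∀ h, ‖Glim (x + h) - Glim x - D x h‖ ≤ Λ * (‖h‖ ^ α + ‖h‖) * ‖h‖ := fun h =>
      le_of_tendsto (((hlim (x + h)).sub (hlim x)).sub (hD x h)).norm
        (.of_forall fun n => norm_taylor_remainder_le_of_modulus hω (hdiff n) (hmod n) x h)
    rw [hasFDerivAt_iff_isLittleO_nhds_zero, Asymptotics.isLittleO_iff]
    intro c hc
    have hnorm : Tendsto (fun h : E => ‖h‖) (nhds 0) (nhds 0) := by
      simpa using (continuous_norm (E := E)).tendsto 0
    filter_upwards [(hω0.comp hnorm).eventually (gt_mem_nhds hc)] with h hh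
    exact (htaylor h).trans (mul_le_mul_of_nonneg_right (le_of_lt hh) (norm_nonneg h))
  · refine ContinuousLinearMap.opNorm_le_bound _ (by positivity) fun h => ?_
    exact le_of_tendsto ((hD x h).sub (hD y h)).norm
      (.of_forall fun n => (G' n x - G' n y).le_of_opNorm_le (hmod n x y) h)
end
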